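/- Let 1 ≤ q < ∞, let P ⊆ S ⊆ F and R ⊆ G be subspaces such that: R is B-norming for P with some constant c > 0; the closed unit ball of P is compact in the topology τ_B(R); and the closed unit ball of R is compact in the topology τ_B(S). Then every (q,R)-summing operator T : P → E is completely continuous: for every sequence (f_n) in P converging weakly to 0, one has lim_n ‖T f_n‖ = 0. -/

import Mathlib

open scoped BigOperators
open Filter Topology

noncomputable section

variable {F G X E : Type*}
variable [NormedAddCommGroup F] [NormedSpace ℝ F] [CompleteSpace F]
variable [NormedAddCommGroup G] [NormedSpace ℝ G] [CompleteSpace G]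
variable [NormedAddCommGroup X] [NormedSpace ℝ X] [CompleteSpace X]
variable [NormedAddCommGroup E] [NormedSpace ℝ E] [CompleteSpace E]

/-- The closed unit ball of a subspace `R`. -/
def subBall {H : Type*} [NormedAddCommGroup H] [NormedSpace ℝ H] (R : Submodule ℝ H) :
    Set H := {g | g ∈ R ∧ ‖g‖ ≤ 1}

/-- A continuous linear operator `T : P → E` is `(q,R)`-summing with respect to the
continuous bilinear map `B : F × G → X`, with constant `K`. -/
def IsSumming (B : F →L[ℝ] G →L[ℝ] X) (P : Submodule ℝ F) (R : Submodule ℝ G)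
    (q : ℝ) (T : P →L[ℝ] E) (K : ℝ) : Prop :=
  ∀ (n : ℕ) (f : Fin n → P),
    (∑ i, ‖T (f i)‖ ^ q) ^ (1 / q) ≤
      K * sSup ((fun g => (∑ i, ‖B (f i : F) g‖ ^ q) ^ (1 / q)) '' subBall R)

/-- `τ_B(S)`: the locally convex topology on `G` generated by the seminorms
`g ↦ ‖B(f,g)‖` for `f ∈ S`. -/
def tauB (B : F →L[ℝ] G →L[ℝ] X) (S : Submodule ℝ F) : TopologicalSpace G :=
  TopologicalSpace.induced (fun g => fun f : S => B (f : F) g) inferInstance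

/-- `τ_B(R)`: the locally convex topology on `F` generated by the seminorms
`f ↦ ‖B(f,g)‖` for `g ∈ R`. -/
def tauB' (B : F →L[ℝ] G →L[ℝ] X) (R : Submodule ℝ G) : TopologicalSpace F :=
  TopologicalSpace.induced (fun f => fun g : R => B f (g : G)) inferInstance

open MeasureTheory CompactlySupported

/-- On a compact Hausdorff space, a uniformly bounded sequence of continuous functions which
converges pointwise to `0` has convex combinations that are uniformly smaller than any `ε > 0`. -/
theorem exists_mem_convexHull_range_forall_lt {Y : Type*} [TopologicalSpace Y] [CompactSpace Y]
    [T2Space Y] {φ : ℕ → C(Y, ℝ)} {C : ℝ} (hC : ∀ n y, ‖φ n y‖ ≤ C)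
    (hφ : ∀ y, Tendsto (fun n => φ n y) atTop (𝓝 0)) {ε : ℝ} (hε : 0 < ε) :
    ∃ h ∈ convexHull ℝ (Set.range φ), ∀ y, h y < ε := by
  by_contra! hcon
  let s : Set C(Y, ℝ) := {h | ∀ y, h y < ε}
  have hs_open : IsOpen s := by
    have : s = {h : C(Y, ℝ) | Set.MapsTo h Set.univ (Set.Iio ε)} := by
      ext h
      simp [s, Set.MapsTo]
    rw [this]
    exact ContinuousMap.isOpen_setOfPred_mapsTo isCompact_univ isOpen_Iio
  have hs_convex : Convex ℝ s := fun f hf g hg a b ha hb hab y =>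
    (convex_Iio ε) (hf y) (hg y) ha hb hab
  have hdisj : Disjoint s (convexHull ℝ (Set.range φ)) := by
    rw [Set.disjoint_left]
    intro h hhs hh
    obtain ⟨y, hy⟩ := hcon h hh
    exact (hhs y).not_ge hy
  obtain ⟨L, u, hLs, hLφ⟩ :=
    geometric_hahn_banach_open hs_convex hs_open (convex_convexHull ℝ _) hdisj
  have hu : 0 < u := by simpa using hLs 0 (fun y => by simpa using hε)
  have hLpos : ∀ h : C(Y, ℝ), (∀ y, 0 ≤ h y) → 0 ≤ L h := by
    intro h hh
    by_contra! hneg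
    have hmem : (u / L h) • h ∈ s := fun y => by
      have : u / L h * h y ≤ 0 :=
        mul_nonpos_of_nonpos_of_nonneg (div_nonpos_of_nonneg_of_nonpos hu.le hneg.le) (hh y)
      simpa using this.trans_lt hε
    have := hLs _ hmem
    rw [map_smul, smul_eq_mul, div_mul_cancel₀ _ hneg.ne] at this
    exact lt_irrefl _ this
  let _ : MeasurableSpace Y := borel Y
  have : BorelSpace Y := ⟨rfl⟩
  let Λ : C_c(Y, ℝ) →ₚ[ℝ] ℝ := PositiveLinearMap.mk₀
    { toFun := fun f => L f.toContinuousMap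
      map_add' := fun f g => map_add L f.toContinuousMap g.toContinuousMap
      map_smul' := fun c f => map_smul L c f.toContinuousMap }
    (fun f hf => hLpos _ hf)
  have hint : ∀ n, ∫ y, φ n y ∂(RealRMK.rieszMeasure Λ) = L (φ n) := fun n =>
    RealRMK.integral_rieszMeasure Λ (CompactlySupportedContinuousMap.continuousMapEquiv (φ n))
  have hlim : Tendsto (fun n => ∫ y, φ n y ∂(RealRMK.rieszMeasure Λ)) atTop (𝓝 0) := by
    simpa using tendsto_integral_of_dominated_convergence (μ := RealRMK.rieszMeasure Λ)
      (F := fun n y => φ n y) (f := fun _ => 0) (fun _ => C)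
      (fun n => (φ n).continuous.aestronglyMeasurable) (integrable_const C)
      (fun n => ae_of_all _ (hC n)) (ae_of_all _ hφ)
  simp only [hint] at hlim
  exact hu.not_ge (ge_of_tendsto' hlim fun n => hLφ _ (subset_convexHull ℝ _ ⟨n, rfl⟩))

/-- A weakly null sequence contained in a norm-compact set is norm null. -/
theorem IsCompact.tendsto_zero_of_forall_dual {V : Type*} [NormedAddCommGroup V]
    [NormedSpace ℝ V] {s : Set V} (hs : IsCompact s) {x : ℕ → V} (hxs : ∀ n, x n ∈ s)
    (hx : ∀ ψ : V →L[ℝ] ℝ, Tendsto (fun n => ψ (x n)) atTop (𝓝 0)) :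
    Tendsto x atTop (𝓝 0) := by
  refine hs.tendsto_nhds_of_unique_mapClusterPt (.of_forall hxs) fun y _ hy => ?_
  refine SeparatingDual.eq_zero_of_forall_dual_eq_zero (R := ℝ) fun ψ => ?_
  have hclus : MapClusterPt (ψ y) atTop (ψ ∘ x) := hy.continuousAt_comp ψ.continuous.continuousAt
  have : (𝓝 (ψ y) ⊓ 𝓝 0).NeBot := hclus.neBot.mono (inf_le_inf_left _ (hx ψ))
  exact eq_of_nhds_neBot this

/-- A weakly null sequence in a normed space is bounded. -/
theorem exists_norm_le_of_forall_dual_tendsto {V : Type*} [NormedAddCommGroup V]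
    [NormedSpace ℝ V] {x : ℕ → V}
    (hx : ∀ ψ : V →L[ℝ] ℝ, Tendsto (fun n => ψ (x n)) atTop (𝓝 0)) :
    ∃ C, 0 < C ∧ ∀ n, ‖x n‖ ≤ C := by
  obtain ⟨C, hC⟩ := banach_steinhaus (g := fun n => NormedSpace.inclusionInDoubleDual ℝ V (x n))
    fun ψ => by
      obtain ⟨C, hC⟩ := (hx ψ).norm.bddAbove_range
      exact ⟨C, fun n => hC ⟨n, rfl⟩⟩
  refine ⟨max C 1, by positivity, fun n => le_max_of_le_left ?_⟩
  rw [← (NormedSpace.inclusionInDoubleDualLi ℝ (E := V)).norm_map (x n)]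
  exact hC n

theorem zero_mem_subBall {H : Type*} [NormedAddCommGroup H] [NormedSpace ℝ H]
    (R : Submodule ℝ H) : (0 : H) ∈ subBall R := ⟨R.zero_mem, by simp⟩

omit [CompleteSpace F] [CompleteSpace G] [CompleteSpace X] [CompleteSpace E] in
/-- The summing inequality, in its weighted form. -/
theorem IsSumming.sum_mul_le {B : F →L[ℝ] G →L[ℝ] X} {P : Submodule ℝ F} {R : Submodule ℝ G}
    {q : ℝ} {T : P →L[ℝ] E} {K : ℝ} (hT : IsSumming B P R q T K) (hK : 0 ≤ K) (hq : 0 < q)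
    {ι : Type*} [Fintype ι] {w : ι → ℝ} (hw : ∀ i, 0 ≤ w i) (y : ι → P) {M : ℝ} (hM : 0 ≤ M)
    (hB : ∀ g ∈ subBall R, ∑ i, w i * ‖B (y i : F) g‖ ^ q ≤ M) :
    ∑ i, w i * ‖T (y i)‖ ^ q ≤ K ^ q * M := by
  have hscale : ∀ i (t : ℝ), 0 ≤ t → (w i ^ (1 / q) * t) ^ q = w i * t ^ q := fun i t ht => by
    rw [Real.mul_rpow (Real.rpow_nonneg (hw i) _) ht, ← Real.rpow_mul (hw i),
      one_div_mul_cancel hq.ne', Real.rpow_one]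
  let e := Fintype.equivFin ι
  have h := hT (Fintype.card ι) fun j => w (e.symm j) ^ (1 / q) • y (e.symm j)
  simp only [map_smul, Submodule.coe_smul, smul_apply, norm_smul,
    Real.norm_of_nonneg (Real.rpow_nonneg (hw _) _), hscale _ _ (norm_nonneg _)] at h
  rw [e.symm.sum_comp (fun i => w i * ‖T (y i)‖ ^ q)] at h
  simp only [fun g => e.symm.sum_comp (fun i => w i * ‖B (y i : F) g‖ ^ q)] at h
  have hsup : sSup ((fun g => (∑ i, w i * ‖B (y i : F) g‖ ^ q) ^ (1 / q)) '' subBall R) ≤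
      M ^ (1 / q) := by
    refine csSup_le (Set.Nonempty.image _ ⟨0, zero_mem_subBall R⟩) ?_
    rintro _ ⟨g, hg, rfl⟩
    exact Real.rpow_le_rpow (Finset.sum_nonneg fun i _ =>
      mul_nonneg (hw i) (Real.rpow_nonneg (norm_nonneg _) _)) (hB g hg) (by positivity)
  have hA : 0 ≤ ∑ i, w i * ‖T (y i)‖ ^ q := Finset.sum_nonneg fun i _ =>
      mul_nonneg (hw i) (Real.rpow_nonneg (norm_nonneg _) _)
  have h' := Real.rpow_le_rpow (Real.rpow_nonneg hA _)
    (h.trans (mul_le_mul_of_nonneg_left hsup hK)) hq.le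
  rwa [Real.mul_rpow hK (Real.rpow_nonneg hM _), ← Real.rpow_mul hA, ← Real.rpow_mul hM,
    one_div_mul_cancel hq.ne', Real.rpow_one, Real.rpow_one] at h'

omit [CompleteSpace F] [CompleteSpace G] [CompleteSpace X] in
/-- If the unit ball of `P` is `τ_B(R)`-compact, then `B(·, g)` is completely continuous on `P`
for every `g ∈ R`. -/
theorem tendsto_apply_of_isCompact_subBall {B : F →L[ℝ] G →L[ℝ] X} {P : Submodule ℝ F}
    {R : Submodule ℝ G} (hPcomp : @IsCompact F (tauB' B R) (subBall P)) {f : ℕ → P}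
    (hf : ∀ φ : P →L[ℝ] ℝ, Tendsto (fun n => φ (f n)) atTop (𝓝 0)) {g : G} (hg : g ∈ R) :
    Tendsto (fun n => B (f n : F) g) atTop (𝓝 0) := by
  obtain ⟨C, hC0, hC⟩ := exists_norm_le_of_forall_dual_tendsto hf
  have hcont : @Continuous F X (tauB' B R) _ (fun u => C • B u g) := by
    let _ := tauB' B R
    have h : Continuous (fun u : F => fun g : R => B u (g : G)) := continuous_induced_dom
    exact ((continuous_apply (⟨g, hg⟩ : R)).comp h).const_smul C
  have himage : IsCompact ((fun u => C • B u g) '' subBall P) :=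
    @IsCompact.image F X (tauB' B R) _ _ _ hPcomp hcont
  refine himage.tendsto_zero_of_forall_dual (fun n => ?_) fun ψ => ?_
  · refine ⟨C⁻¹ • (f n : F), ⟨P.smul_mem _ (f n).2, ?_⟩, ?_⟩
    · rw [norm_smul, norm_inv, Real.norm_of_nonneg hC0.le, inv_mul_le_one₀ hC0]
      exact hC n
    · simp [smul_smul, hC0.ne']
  · exact hf ((ψ ∘L B.flip g) ∘L P.subtypeL)

/-- If `P ⊆ S ⊆ F` and `R ⊆ G` are such that `R` is `B`-norming for `P` with constant
`c > 0`, the closed unit ball of `P` is `τ_B(R)`-compact and the closed unit ball of `R`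
is `τ_B(S)`-compact, then every `(q,R)`-summing operator `T : P → E` is completely
continuous: `‖T f_n‖ → 0` whenever `f_n → 0` weakly in `P`. -/
theorem summing_completely_continuous (B : F →L[ℝ] G →L[ℝ] X) (P S : Submodule ℝ F)
    (R : Submodule ℝ G) (q : ℝ) (hq : 1 ≤ q) (hPS : P ≤ S)
    (c : ℝ) (hc : 0 < c)
    (hnorm : ∀ f ∈ P, c * ‖f‖ ≤ sSup ((fun g => ‖B f g‖) '' subBall R))
    (hPcomp : @IsCompact F (tauB' B R) (subBall P))
    (hRcomp : @IsCompact G (tauB B S) (subBall R))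
    (T : P →L[ℝ] E) (hT : ∃ K, 0 ≤ K ∧ IsSumming B P R q T K) :
    ∀ f : ℕ → P,
      (∀ φ : P →L[ℝ] ℝ, Tendsto (fun n => φ (f n)) atTop (𝓝 0)) →
      Tendsto (fun n => ‖T (f n)‖) atTop (𝓝 0) := by
  intro f hf
  obtain ⟨K, hK, hT⟩ := hT
  have hq0 : 0 < q := zero_lt_one.trans_le hq
  obtain ⟨C, hC0, hC⟩ := exists_norm_le_of_forall_dual_tendsto hf
  by_contra hcon
  obtain ⟨δ, hδ, hfreq⟩ : ∃ δ > 0, ∃ᶠ n in atTop, δ ≤ ‖T (f n)‖ := by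
    simpa [Metric.tendsto_nhds, frequently_atTop] using hcon
  obtain ⟨k, hk, hkδ⟩ := extraction_of_frequently_atTop hfreq
  let Φ : G → S → X := fun g u => B (u : F) g
  have hY : IsCompact (Φ '' subBall R) := by
    let _ := tauB B S
    exact hRcomp.image continuous_induced_dom
  have : CompactSpace (Φ '' subBall R) := isCompact_iff_compactSpace.1 hY
  let φ : ℕ → C(Φ '' subBall R, ℝ) := fun n =>
    { toFun := fun y => ‖y.1 ⟨f (k n), hPS (f (k n)).2⟩‖ ^ q
      continuous_toFun := (((continuous_apply _).comp continuous_subtype_val).norm).rpow_const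
        fun _ => Or.inr hq0.le }
  have hφC : ∀ n y, ‖φ n y‖ ≤ (‖B‖ * C) ^ q := by
    rintro n ⟨_, g, hg, rfl⟩
    have hle : ‖B (f (k n) : F) g‖ ≤ ‖B‖ * C := by
      calc ‖B (f (k n) : F) g‖ ≤ ‖B‖ * ‖f (k n)‖ * ‖g‖ := B.le_opNorm₂ _ _
        _ ≤ ‖B‖ * C * 1 := by
          gcongr
          exacts [hC _, hg.2]
        _ = ‖B‖ * C := mul_one _
    change ‖‖B (f (k n) : F) g‖ ^ q‖ ≤ _
    rw [Real.norm_of_nonneg (by positivity)]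
    gcongr
  have hφ0 : ∀ y, Tendsto (fun n => φ n y) atTop (𝓝 0) := by
    rintro ⟨_, g, hg, rfl⟩
    have h := ((tendsto_apply_of_isCompact_subBall hPcomp hf hg.1).comp
      hk.tendsto_atTop).norm.rpow_const (p := q) (Or.inr hq0.le)
    rwa [norm_zero, Real.zero_rpow hq0.ne'] at h
  let ε : ℝ := δ ^ q / (K ^ q + 1)
  have hε : 0 < ε := by positivity
  obtain ⟨h, hconv, hlt⟩ := exists_mem_convexHull_range_forall_lt hφC hφ0 hε
  obtain ⟨ι, _, w, z, hw, hw1, hz, rfl⟩ := mem_convexHull_iff_exists_fintype.1 hconv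
  choose m hm using hz
  have hupper := hT.sum_mul_le hK hq0 hw (fun i => f (k (m i))) hε.le fun g hg => by
    have h := (hlt ⟨Φ g, g, hg, rfl⟩).le
    simpa [← hm, φ, Φ] using h
  have hlower : δ ^ q ≤ ∑ i, w i * ‖T (f (k (m i)))‖ ^ q := by
    calc δ ^ q = ∑ i, w i * δ ^ q := by rw [← Finset.sum_mul, hw1, one_mul]
      _ ≤ _ := Finset.sum_le_sum fun i _ => mul_le_mul_of_nonneg_left
        (Real.rpow_le_rpow hδ.le (hkδ _) hq0.le) (hw i)
  have hcancel : (K ^ q + 1) * ε = δ ^ q := mul_div_cancel₀ _ (by positivity)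
  linarith
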